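/- Suppose k has positive characteristic p, K is a separably generated function field over k, m a natural number, and b ∈ (K*)^M is such that for some index j the vector ψ_j(b) (b with its j-th component replaced by 1) has components linearly independent over kK^{p^m}. Then there exists a point P ∈ K^M with b·P = 1 such that for every place v of K/k, any solution c ∈ ((kK^{p^m})*_v)^M of b·c = 1 equals P. -/

import Mathlib

/-- A place of a function field `K/k`: a normalized discrete (additive) valuation on `K`
trivial on `k`. -/
structure FnPlace (k K : Type*) [Field k] [Field K] [Algebra k K] where
  v : K → ℤ
  v_mul : ∀ {x y : K}, x ≠ 0 → y ≠ 0 → v (x * y) = v x + v y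
  v_add : ∀ {x y : K}, x ≠ 0 → y ≠ 0 → x + y ≠ 0 → min (v x) (v y) ≤ v (x + y)
  exists_uniformizer : ∃ s : K, s ≠ 0 ∧ v s = 1
  v_const : ∀ c : k, c ≠ 0 → v (algebraMap k K c) = 0

namespace FnPlace
variable {k K : Type*} [Field k] [Field K] [Algebra k K] (v : FnPlace k K)

/-- valuation at least `n`, with `v 0 = ∞`. -/
def V (n : ℤ) (x : K) : Prop := x = 0 ∨ n ≤ v.v x

theorem v_one : v.v 1 = 0 := by
  have := v.v_mul (x := 1) (y := 1) one_ne_zero one_ne_zero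
  simp at this; exact this

theorem v_inv {x : K} (hx : x ≠ 0) : v.v x⁻¹ = - v.v x := by
  have := v.v_mul hx (inv_ne_zero hx)
  rw [mul_inv_cancel₀ hx, v.v_one] at this; omega

theorem v_pow {x : K} (hx : x ≠ 0) (n : ℕ) : v.v (x ^ n) = n * v.v x := by
  induction n with
  | zero => simp [v.v_one]
  | succ n ih => rw [pow_succ, v.v_mul (pow_ne_zero _ hx) hx, ih]; push_cast; ring

theorem v_zpow {x : K} (hx : x ≠ 0) (n : ℤ) : v.v (x ^ n) = n * v.v x := by
  cases n with
  | ofNat n => simpa using v.v_pow hx n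
  | negSucc n =>
    rw [zpow_negSucc, v.v_inv (pow_ne_zero _ hx), v.v_pow hx, Int.negSucc_eq]; push_cast; ring

theorem v_neg_one : v.v (-1) = 0 := by
  have h := v.v_pow (x := -1) (neg_ne_zero.2 one_ne_zero) 2
  rw [neg_one_sq, v.v_one] at h; push_cast at h; omega

variable {v}

theorem V.mono {n m : ℤ} {x : K} (h : v.V n x) (hm : m ≤ n) : v.V m x :=
  h.imp id (fun h => hm.trans h)

theorem V.zero (n : ℤ) : v.V n 0 := Or.inl rfl

theorem V.add {n : ℤ} {x y : K} (hx : v.V n x) (hy : v.V n y) : v.V n (x + y) := by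
  by_cases h0 : x = 0
  · simpa [h0] using hy
  by_cases h1 : y = 0
  · simpa [h1] using hx
  by_cases h2 : x + y = 0
  · exact Or.inl h2
  have := v.v_add h0 h1 h2
  rcases hx with hx | hx
  · exact absurd hx h0
  rcases hy with hy | hy
  · exact absurd hy h1
  exact Or.inr ((le_min hx hy).trans this)

theorem V.mul {n m : ℤ} {x y : K} (hx : v.V n x) (hy : v.V m y) : v.V (n + m) (x * y) := by
  by_cases h0 : x = 0
  · exact Or.inl (by simp [h0])
  by_cases h1 : y = 0
  · exact Or.inl (by simp [h1])
  rcases hx with hx | hx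
  · exact absurd hx h0
  rcases hy with hy | hy
  · exact absurd hy h1
  exact Or.inr (by rw [v.v_mul h0 h1]; omega)

theorem V.neg {n : ℤ} {x : K} (hx : v.V n x) : v.V n (-x) := by
  have := V.mul (v := v) (n := 0) (Or.inr v.v_neg_one.ge) hx
  simpa using this

theorem V.sum {n : ℤ} {ι : Type*} (s : Finset ι) (f : ι → K) (h : ∀ i ∈ s, v.V n (f i)) :
    v.V n (∑ i ∈ s, f i) := by
  classical
  induction s using Finset.induction_on with
  | empty => simpa using V.zero n
  | insert a s ha ih =>
    rw [Finset.sum_insert ha]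
    exact (h a (by simp)).add (ih fun i hi => h i (by simp [hi]))

theorem V.one : v.V 0 1 := Or.inr v.v_one.ge

variable (v)

/-- the valuation ring -/
def O : ValuationSubring K where
  carrier := {x | v.V 0 x}
  mul_mem' hx hy := by simpa using V.mul hx hy
  one_mem' := V.one
  add_mem' hx hy := V.add hx hy
  zero_mem' := V.zero 0
  neg_mem' hx := V.neg hx
  mem_or_inv_mem' x := by
    by_cases h : x = 0
    · exact Or.inl (Or.inl h)
    rcases le_total 0 (v.v x) with h1 | h1
    · exact Or.inl (Or.inr h1)
    · exact Or.inr (Or.inr (by rw [v.v_inv h]; omega))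

theorem mem_O {x : K} : x ∈ v.O ↔ v.V 0 x := Iff.rfl

theorem algebraMap_mem_O (c : k) : algebraMap k K c ∈ v.O := by
  by_cases h : c = 0
  · simp [h]
  · exact Or.inr (v.v_const c h).ge

theorem mem_O_of_integral {t : K} (ht : t ∈ v.O) {x : K}
    (hx : IsIntegral (Algebra.adjoin k {t}) x) : x ∈ v.O := by
  have hle : ∀ y ∈ Algebra.adjoin k {t}, y ∈ v.O := by
    intro y hy
    induction hy using Algebra.adjoin_induction with
    | mem y hy => rw [Set.mem_singleton_iff.1 hy]; exact ht
    | algebraMap c => exact v.algebraMap_mem_O c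
    | add _ _ _ _ h1 h2 => exact add_mem h1 h2
    | mul _ _ _ _ h1 h2 => exact mul_mem h1 h2
  let f : Algebra.adjoin k {t} →+* v.O :=
    { toFun := fun y => ⟨y, hle _ y.2⟩
      map_one' := rfl
      map_mul' := fun _ _ => rfl
      map_zero' := rfl
      map_add' := fun _ _ => rfl }
  have h := hx.map_of_comp_eq f (RingHom.id K) (by ext; rfl)
  obtain ⟨y, hy⟩ := IsIntegrallyClosed.isIntegral_iff.1 h
  have : (y : K) = x := hy
  rw [← this]; exact y.2

end FnPlace

open IntermediateField.algebraAdjoinAdjoin in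
theorem exists_dedekind_model {k K : Type*} [Field k] [Field K] [Algebra k K] (t : K)
    (ht : Transcendental k t)
    (hfd : FiniteDimensional ↥(IntermediateField.adjoin k {t}) K)
    (hsep : Algebra.IsSeparable ↥(IntermediateField.adjoin k {t}) K) :
    ∃ A : Subalgebra k K, Algebra.FiniteType k A ∧ IsDedekindDomain A ∧ IsFractionRing A K ∧
      ∀ x ∈ A, IsIntegral (Algebra.adjoin k {t}) x := by
  let R := Algebra.adjoin k {t}
  let e := Polynomial.algEquivOfTranscendental k t ht
  have : IsPrincipalIdealRing R :=
    IsPrincipalIdealRing.of_surjective e.toRingEquiv.toRingHom e.surjective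
  have hD : IsDedekindDomain (integralClosure R K) :=
    integralClosure.isDedekindDomain R (IntermediateField.adjoin k {t}) K
  have hFr : IsFractionRing (integralClosure R K) K :=
    integralClosure.isFractionRing_of_finite_extension (IntermediateField.adjoin k {t}) K
  have hfin : Module.Finite R (integralClosure R K) :=
    IsIntegralClosure.finite R (IntermediateField.adjoin k {t}) K _
  have hft : Algebra.FiniteType k R := Algebra.FiniteType.equiv inferInstance e
  refine ⟨(integralClosure R K).restrictScalars k, ?_, hD, hFr, fun x hx => hx⟩
  have h2 : Algebra.FiniteType k (integralClosure R K) :=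
    Algebra.FiniteType.trans hft inferInstance
  exact h2

theorem FnPlace.exists_model {k K : Type*} [Field k] [Field K] [Algebra k K]
    (hsepgen : ∃ t : K, Transcendental k t ∧
      FiniteDimensional ↥(IntermediateField.adjoin k {t}) K ∧
      Algebra.IsSeparable ↥(IntermediateField.adjoin k {t}) K) (v : FnPlace k K) :
    ∃ A : Subalgebra k K, Algebra.FiniteType k A ∧ (∀ x ∈ A, v.V 0 x) ∧
      ∀ x : K, v.V 0 x → ∃ a ∈ A, ∃ y ∈ A, y ≠ 0 ∧ v.v y = 0 ∧ x * y = a := by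
  obtain ⟨t, htr, hfd, hsep, ht⟩ : ∃ t : K, Transcendental k t ∧
      FiniteDimensional ↥(IntermediateField.adjoin k {t}) K ∧
      Algebra.IsSeparable ↥(IntermediateField.adjoin k {t}) K ∧ t ∈ v.O := by
    obtain ⟨t, h1, h2, h3⟩ := hsepgen
    rcases v.O.mem_or_inv_mem t with h | h
    · exact ⟨t, h1, h2, h3, h⟩
    · have he : IntermediateField.adjoin k {t⁻¹} = IntermediateField.adjoin k {t} := by
        apply le_antisymm
        · rw [IntermediateField.adjoin_simple_le_iff]
          exact inv_mem (IntermediateField.mem_adjoin_simple_self k t)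
        · rw [IntermediateField.adjoin_simple_le_iff]
          simpa using inv_mem (IntermediateField.mem_adjoin_simple_self k t⁻¹)
      refine ⟨t⁻¹, ?_, ?_, ?_, h⟩
      · rwa [Transcendental, IsAlgebraic.inv_iff]
      · rw [he]; exact h2
      · rw [he]; exact h3
  obtain ⟨A, hft, hD, hFr, hint⟩ := exists_dedekind_model t htr hfd hsep
  have hA : ∀ x ∈ A, v.V 0 x := fun x hx => v.mem_O_of_integral ht (hint x hx)
  refine ⟨A, hft, hA, ?_⟩
  have hfrac : ∀ x : K, ∃ a b : A, b ≠ 0 ∧ x * b = a := by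
    intro x
    obtain ⟨a, b, hb, h⟩ := IsFractionRing.div_surjective (A := A) x
    have hb0 : b ≠ 0 := nonZeroDivisors.ne_zero hb
    refine ⟨a, b, hb0, ?_⟩
    have : (b : K) ≠ 0 := by simpa using hb0
    rw [← h]
    change (a : K) / b * b = a
    field_simp
  let P : Ideal A :=
    { carrier := {x | v.V 1 (x : K)}
      add_mem' := fun hx hy => by
        simp only [Set.mem_setOf_eq] at *
        exact FnPlace.V.add hx hy
      zero_mem' := FnPlace.V.zero 1
      smul_mem' := fun c x hx => by
        simp only [Set.mem_setOf_eq] at *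
        simpa using FnPlace.V.mul (hA c c.2) hx }
  have hmem : ∀ x : A, x ∈ P ↔ v.V 1 (x : K) := fun x => Iff.rfl
  have hnmem : ∀ x : A, x ∉ P → (x : K) ≠ 0 ∧ v.v (x : K) = 0 := by
    intro x hx
    rw [hmem, FnPlace.V, not_or] at hx
    have h := hA x x.2
    refine ⟨hx.1, ?_⟩
    rcases h with h | h
    · exact absurd h hx.1
    · omega
  have hPp : P.IsPrime := by
    refine ⟨?_, ?_⟩
    · rw [Ideal.ne_top_iff_one, hmem]
      rintro (h | h)
      · exact one_ne_zero h
      · have := v.v_one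
        simp at h
        omega
    · intro x y hxy
      by_contra! hcon
      obtain ⟨h1, h2⟩ := hnmem x hcon.1
      obtain ⟨h3, h4⟩ := hnmem y hcon.2
      rcases hxy with h | h
      · exact mul_ne_zero h1 h3 h
      · change 1 ≤ v.v ((x : K) * y) at h
        rw [v.v_mul h1 h3] at h
        omega
  have hP0 : P ≠ ⊥ := by
    obtain ⟨s, hs0, hs⟩ := v.exists_uniformizer
    obtain ⟨a, b, hb, h⟩ := hfrac s
    have hb' : (b : K) ≠ 0 := by simpa using hb
    have ha : a ∈ P := by
      rw [hmem, ← h]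
      simpa using FnPlace.V.mul (v := v) (Or.inr hs.ge : v.V 1 s) (hA b b.2)
    intro hbot
    rw [hbot, Ideal.mem_bot] at ha
    rw [ha] at h
    simp [hs0, hb] at h
  have hdvr := IsLocalization.AtPrime.isDiscreteValuationRing_of_dedekind_domain A hP0
    (Localization.AtPrime P)
  have key : ∀ a b : A, ∃ c s : A, s ∉ P ∧ (a * c = b * s ∨ b * c = a * s) := by
    intro a b
    obtain ⟨z, hz⟩ := ValuationRing.cond (algebraMap A (Localization.AtPrime P) a)
      (algebraMap A (Localization.AtPrime P) b)
    obtain ⟨⟨c, s⟩, hcs⟩ := IsLocalization.surj P.primeCompl z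
    refine ⟨c, s, s.2, ?_⟩
    have hinj : Function.Injective (algebraMap A (Localization.AtPrime P)) :=
      IsLocalization.injective _ P.primeCompl_le_nonZeroDivisors
    refine hz.imp (fun h => hinj ?_) (fun h => hinj ?_)
    · simp only at hcs
      rw [map_mul, map_mul, ← hcs, ← h]; ring
    · simp only at hcs
      rw [map_mul, map_mul, ← hcs, ← h]; ring
  intro x hx
  by_cases hx0 : x = 0
  · exact ⟨0, zero_mem _, 1, one_mem _, one_ne_zero, v.v_one, by simp [hx0]⟩
  replace hx : 0 ≤ v.v x := hx.resolve_left hx0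
  obtain ⟨a, b, hb, h⟩ := hfrac x
  have hb' : (b : K) ≠ 0 := by simpa using hb
  obtain ⟨c, s, hs, hcs⟩ := key a b
  obtain ⟨hs0, hs1⟩ := hnmem s hs
  rcases hcs with hcs | hcs
  · -- x * c = s
    have h1 : (a : K) * c = b * s := by exact_mod_cast congrArg (Subtype.val) hcs
    have h2 : x * c = s := by
      apply mul_left_cancel₀ hb'
      rw [← h1, ← h]; ring
    have hc0 : (c : K) ≠ 0 := by
      rintro h3
      rw [h3, mul_zero] at h2
      exact hs0 h2.symm
    refine ⟨s, s.2, c, c.2, hc0, ?_, h2⟩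
    have h3 := v.v_mul hx0 hc0
    rw [h2, hs1] at h3
    have := (hA c c.2).resolve_left hc0
    omega
  · have h1 : (b : K) * c = a * s := by exact_mod_cast congrArg (Subtype.val) hcs
    refine ⟨c, c.2, s, s.2, hs0, hs1, ?_⟩
    apply mul_left_cancel₀ hb'
    rw [h1, ← h]; ring

theorem FnPlace.exists_gens {k K : Type*} [Field k] [Field K] [Algebra k K]
    (hsepgen : ∃ t : K, Transcendental k t ∧
      FiniteDimensional ↥(IntermediateField.adjoin k {t}) K ∧
      Algebra.IsSeparable ↥(IntermediateField.adjoin k {t}) K) (v : FnPlace k K)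
    (F : Subfield K) (hk : ∀ c : k, algebraMap k K c ∈ F) (q : ℕ) (hq0 : 0 < q)
    (hq : ∀ x : K, x ^ q ∈ F) :
    ∃ (r : ℕ) (g : Fin r → K), ∀ (n : ℤ) (x : K), v.V (q * n) x →
      ∃ f : Fin r → F, x = ∑ i, (f i : K) * g i ∧ ∀ i, v.V (q * n) (f i : K) := by
  obtain ⟨A, hft, hA, hx⟩ := v.exists_model hsepgen
  let B : Subalgebra k A :=
    { carrier := {a | (a : K) ∈ F}
      mul_mem' := fun ha hb => mul_mem (S := Subfield K) (s := F) ha hb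
      add_mem' := fun ha hb => add_mem (S := Subfield K) (s := F) ha hb
      algebraMap_mem' := fun c => hk c }
  have hft2 : Algebra.FiniteType B A := Algebra.FiniteType.of_restrictScalars_finiteType k B A
  have hint : Algebra.IsIntegral B A := by
    refine ⟨fun a => ?_⟩
    refine IsIntegral.of_pow hq0 ?_
    have : a ^ q = algebraMap B A ⟨a ^ q, hq (a : K)⟩ := rfl
    rw [this]
    exact isIntegral_algebraMap
  have hfin : Module.Finite B A := Algebra.IsIntegral.finite
  obtain ⟨r, g, hg⟩ := Module.Finite.exists_fin (R := B) (M := A)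
  refine ⟨r, fun i => g i, fun n x hxn => ?_⟩
  obtain ⟨s, hs0, hs1⟩ := v.exists_uniformizer
  have hz0 : (s ^ n) ^ q ≠ 0 := pow_ne_zero _ (zpow_ne_zero _ hs0)
  have hvz : v.v ((s ^ n) ^ q) = q * n := by
    rw [v.v_pow (zpow_ne_zero _ hs0), v.v_zpow hs0, hs1]; ring
  obtain ⟨a, ha, y, hy, hy0, hvy, hay⟩ := hx (x * ((s ^ n) ^ q)⁻¹) (by
    have := FnPlace.V.mul hxn (Or.inr (v.v_inv hz0).ge : v.V _ ((s ^ n) ^ q)⁻¹)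
    rw [hvz] at this
    simpa using this)
  have hmem : (⟨a, ha⟩ * ⟨y, hy⟩ ^ (q - 1) : A) ∈ Submodule.span B (Set.range g) := by
    rw [hg]; trivial
  obtain ⟨c, hc⟩ := (Submodule.mem_span_range_iff_exists_fun B).1 hmem
  have hc' : ∑ i, ((c i : A) : K) * (g i : K) = a * y ^ (q - 1) := by
    have := congrArg A.val hc
    simpa [map_sum, Algebra.smul_def] using this
  have hyq : y ^ q ≠ 0 := pow_ne_zero _ hy0
  have hyq1 : y ^ (q - 1) * y = y ^ q := by
    rw [← pow_succ]; congr 1; omega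
  refine ⟨fun i => ⟨((c i : A) : K) * ((s ^ n) ^ q * (y ^ q)⁻¹), ?_⟩, ?_, ?_⟩
  · exact mul_mem (c i).2 (mul_mem (hq _) (inv_mem (hq _)))
  · have h1 : ∑ i, ((c i : A) : K) * ((s ^ n) ^ q * (y ^ q)⁻¹) * (g i : K)
        = (∑ i, ((c i : A) : K) * (g i : K)) * ((s ^ n) ^ q * (y ^ q)⁻¹) := by
      rw [Finset.sum_mul]
      exact Finset.sum_congr rfl fun i _ => by ring
    simp only
    rw [h1, hc', ← hay]
    rw [← hyq1] at hyq ⊢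
    generalize (s ^ n) ^ q = z at *
    have := left_ne_zero_of_mul hyq
    field_simp
  · intro i
    have h1 : v.v ((s ^ n) ^ q * (y ^ q)⁻¹) = q * n := by
      rw [v.v_mul hz0 (inv_ne_zero hyq), hvz, v.v_inv hyq, v.v_pow hy0, hvy]; simp
    have := FnPlace.V.mul (hA _ (c i : A).2) (Or.inr h1.ge : v.V _ ((s ^ n) ^ q * (y ^ q)⁻¹))
    simpa using this

theorem FnPlace.continuous_functional {k K : Type*} [Field k] [Field K] [Algebra k K]
    (hsepgen : ∃ t : K, Transcendental k t ∧
      FiniteDimensional ↥(IntermediateField.adjoin k {t}) K ∧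
      Algebra.IsSeparable ↥(IntermediateField.adjoin k {t}) K) (v : FnPlace k K)
    (F : Subfield K) (hk : ∀ c : k, algebraMap k K c ∈ F) (q : ℕ) (hq0 : 0 < q)
    (hq : ∀ x : K, x ^ q ∈ F) (φ : K →ₗ[F] F) (n : ℤ) :
    ∃ n' : ℤ, ∀ x : K, v.V n' x → v.V n (φ x : K) := by
  obtain ⟨r, g, h⟩ := v.exists_gens hsepgen F hk q hq0 hq
  obtain ⟨C, hC⟩ : ∃ C : ℤ, ∀ i, v.V C (φ (g i) : K) := by
    obtain ⟨C, hC⟩ := (Set.finite_range fun i => v.v (φ (g i) : K)).bddBelow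
    exact ⟨C, fun i => Or.inr (hC ⟨i, rfl⟩)⟩
  refine ⟨q * |n - C|, fun x hx => ?_⟩
  obtain ⟨f, hf, hfv⟩ := h _ x hx
  have : (φ x : K) = ∑ i, (f i : K) * (φ (g i) : K) := by
    conv_lhs => rw [hf]
    have h1 : ∀ i, (f i : K) * g i = f i • g i := fun i => rfl
    simp only [h1, map_sum, map_smul]
    simp
  rw [this]
  refine FnPlace.V.sum _ _ fun i _ => ((hfv i).mul (hC i)).mono ?_
  have h1 : (1 : ℤ) ≤ q := by exact_mod_cast hq0
  have h2 := abs_nonneg (n - C)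
  have h3 := le_abs_self (n - C)
  nlinarith

/-- `k` of characteristic `p > 0`, `K/k` a separably generated function
field, `m : ℕ`, `b ∈ (K*)^M` such that for some index `j₀` the vector `ψ_{j₀}(b)` (i.e.
`b` with the `j₀`-th component replaced by `1`) has components linearly independent over
`F = kK^{p^m}`.  Then there is `P ∈ K^M` with `b·P = 1` such that for every place `v`,
any solution `c` of `b·c = 1` with all coordinates in the closure of `F*` in `K_v*`
equals `P`.  Coordinates `c_j` of such a solution are encoded as limits of `v`-adically
Cauchy sequences `u j` of nonzero elements of `F` with eventually constant valuation, the
equation `b·c = 1` as `v (Σ_j b_j u_j(i) − 1) → ∞`, and `c = P` as `u j → P j`. -/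
theorem stmt14 {k K : Type*} [Field k] [Field K] [Algebra k K]
    (p : ℕ) [Fact p.Prime] [CharP K p]
    (hsepgen : ∃ t : K, Transcendental k t ∧
      FiniteDimensional ↥(IntermediateField.adjoin k {t}) K ∧
      Algebra.IsSeparable ↥(IntermediateField.adjoin k {t}) K)
    (m : ℕ) (M : ℕ) (b : Fin M → K) (hb0 : ∀ j, b j ≠ 0)
    (F : Subfield K)
    (hF : F = Subfield.closure
      (Set.range (algebraMap k K) ∪ {y : K | ∃ x : K, x ^ p ^ m = y}))
    (j₀ : Fin M)
    (hli : LinearIndependent ↥F (fun j => if j = j₀ then (1 : K) else b j)) :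
    ∃ P : Fin M → K, (∑ j, b j * P j) = 1 ∧
      ∀ (v : FnPlace k K) (u : Fin M → ℕ → K),
        (∀ j i, u j i ∈ F ∧ u j i ≠ 0) →
        (∀ j, ∃ d : ℤ, ∃ N : ℕ, ∀ i ≥ N, v.v (u j i) = d) →
        (∀ j, ∀ n : ℤ, ∃ N : ℕ, ∀ i i' : ℕ, N ≤ i → N ≤ i' →
          (u j i = u j i' ∨ n ≤ v.v (u j i - u j i'))) →
        (∀ n : ℤ, ∃ N : ℕ, ∀ i ≥ N,
          ((∑ j, b j * u j i) = 1 ∨ n ≤ v.v ((∑ j, b j * u j i) - 1))) →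
        ∀ j, ∀ n : ℤ, ∃ N : ℕ, ∀ i ≥ N,
          (u j i = P j ∨ n ≤ v.v (u j i - P j)) := by
  classical
  have hk : ∀ c : k, algebraMap k K c ∈ F := fun c => by
    rw [hF]; exact Subfield.subset_closure (Or.inl ⟨c, rfl⟩)
  have hq : ∀ x : K, x ^ p ^ m ∈ F := fun x => by
    rw [hF]; exact Subfield.subset_closure (Or.inr ⟨x, rfl⟩)
  have hq0 : 0 < p ^ m := pow_pos (Fact.out : p.Prime).pos m
  by_cases h1 : (1 : K) ∈ Submodule.span F (Set.range b)
  · obtain ⟨P, hP⟩ := (Submodule.mem_span_range_iff_exists_fun F).1 h1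
    have hP' : ∑ j, b j * (P j : K) = 1 := by
      rw [← hP]
      exact Finset.sum_congr rfl fun j _ => mul_comm _ _
    refine ⟨fun j => P j, hP', ?_⟩
    have hbli : LinearIndependent F b := by
      rw [linearIndependent_iff_card_le_finrank_span]
      have h2 := linearIndependent_iff_card_le_finrank_span.1 hli
      refine h2.trans ?_
      have : FiniteDimensional F (Submodule.span F (Set.range b)) :=
        FiniteDimensional.span_of_finite F (Set.finite_range b)
      refine Submodule.finrank_mono (Submodule.span_le.2 ?_)
      rintro _ ⟨j, rfl⟩
      by_cases hj : j = j₀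
      · simpa [hj] using h1
      · simpa [hj] using Submodule.subset_span (R := F) (Set.mem_range_self (f := b) j)
    intro v u hu _ _ hlim j n
    obtain ⟨φ, hφ⟩ : ∃ φ : K →ₗ[F] F, ∀ l, φ (b l) = if l = j then 1 else 0 := by
      let B := Module.Basis.extend hbli.linearIndepOn_id
      have hmem : ∀ l, b l ∈ hbli.linearIndepOn_id.extend (Set.subset_univ (Set.range b)) :=
        fun l => hbli.linearIndepOn_id.subset_extend _ ⟨l, rfl⟩
      refine ⟨B.coord ⟨b j, hmem j⟩, fun l => ?_⟩
      have : b l = B ⟨b l, hmem l⟩ := by simp [B]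
      conv_lhs => rw [this]
      rw [Module.Basis.coord_apply, Module.Basis.repr_self, Finsupp.single_apply]
      simp [hbli.injective.eq_iff]
    obtain ⟨n', hn'⟩ := v.continuous_functional hsepgen F hk (p ^ m) hq0 hq φ n
    obtain ⟨N, hN⟩ := hlim n'
    refine ⟨N, fun i hi => ?_⟩
    have h3 : v.V n' (∑ l, b l * u l i - 1) := by
      rcases hN i hi with h | h
      · exact Or.inl (by rw [h, sub_self])
      · exact Or.inr h
    have h4 := hn' _ h3
    have h5 : ∑ l, b l * u l i - 1 = ∑ l, ((⟨u l i, (hu l i).1⟩ : F) - P l) • b l := by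
      rw [← hP', ← Finset.sum_sub_distrib]
      refine Finset.sum_congr rfl fun l _ => ?_
      rw [Subfield.smul_def, smul_eq_mul]
      simp only [AddSubgroupClass.coe_sub]
      ring
    rw [h5, map_sum] at h4
    simp only [map_smul, hφ, smul_eq_mul, mul_ite, mul_one, mul_zero, Finset.sum_ite_eq',
      Finset.mem_univ, if_true] at h4
    exact h4.imp (fun h => sub_eq_zero.1 h) id
  · refine ⟨Pi.single j₀ (b j₀)⁻¹, ?_, ?_⟩
    · rw [Finset.sum_eq_single j₀]
      · simp [hb0]
      · intro j _ hj; simp [hj]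
      · simp
    intro v u hu _ _ hlim
    exfalso
    obtain ⟨φ, hφ1, hφ⟩ := Submodule.exists_le_ker_of_notMem h1
    have hb : ∀ j, φ (b j) = 0 := fun j => hφ (Submodule.subset_span ⟨j, rfl⟩)
    have hφ0 : (φ 1 : K) ≠ 0 := by simpa using hφ1
    obtain ⟨n', hn'⟩ := v.continuous_functional hsepgen F hk (p ^ m) hq0 hq φ
      (v.v (-(φ 1 : K)) + 1)
    obtain ⟨N, hN⟩ := hlim n'
    have h3 : v.V n' (∑ l, b l * u l N - 1) := by
      rcases hN N le_rfl with h | h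
      · exact Or.inl (by rw [h, sub_self])
      · exact Or.inr h
    have h4 := hn' _ h3
    have h5 : ∑ l, b l * u l N = ∑ l, (⟨u l N, (hu l N).1⟩ : F) • b l :=
      Finset.sum_congr rfl fun l _ => mul_comm _ _
    rw [h5, map_sub, map_sum] at h4
    simp only [map_smul, hb, smul_zero, Finset.sum_const_zero, zero_sub] at h4
    rcases h4 with h | h
    · simp at h; exact hφ0 (by simp [h])
    · simp only [NegMemClass.coe_neg] at h; omega
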